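/- arXiv:2212.08181 — 2 statements merged into one kernel-verified Lean document; each statement's English description precedes it below -/
import Mathlib

section
/- Let E, ν, β be real numbers with E ≠ 0, ν ≠ −1 and ν ≠ 1/2, let ε be a real 3×3 symmetric matrix with 1 + β·tr(ε) ≠ 0, and let T be a real 3×3 symmetric matrix. Then ε = ((1+ν)(1+β·tr(ε))/E)·T − (ν(1+β·tr(ε))/E)·tr(T)·I holds if and only if T = 𝔼[ε]/(1+β·tr(ε)); in particular the density-dependent constitutive relation is invertible, with the Cauchy stress given uniquely by T = 𝔼[ε]/(1+β·tr(ε)). -/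
open Matrix

/-- The elasticity tensor `𝔼[M] = c̄₁·M + c̄₂·tr(M)·I` with
`c̄₁ = E/(1+ν)` and `c̄₂ = νE/((1+ν)(1−2ν))`. -/
noncomputable def Ecal (E ν : ℝ) (M : Matrix (Fin 3) (Fin 3) ℝ) : Matrix (Fin 3) (Fin 3) ℝ :=
  (E / (1 + ν)) • M + (ν * E / ((1 + ν) * (1 - 2 * ν))) • M.trace • (1 : Matrix (Fin 3) (Fin 3) ℝ)

theorem density_dependent_relation_invertible (E ν β : ℝ) (hE : E ≠ 0) (hν1 : ν ≠ -1)
    (hν2 : ν ≠ 1 / 2) (ε T : Matrix (Fin 3) (Fin 3) ℝ) (hε : ε = εᵀ) (hT : T = Tᵀ)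
    (hden : 1 + β * ε.trace ≠ 0) :
    (ε = ((1 + ν) * (1 + β * ε.trace) / E) • T -
        (ν * (1 + β * ε.trace) / E) • T.trace • (1 : Matrix (Fin 3) (Fin 3) ℝ)) ↔
      T = (1 + β * ε.trace)⁻¹ • Ecal E ν ε := by
  have h1 : 1 + ν ≠ 0 := fun h => hν1 (by linarith)
  have h2 : 1 - ν * 2 ≠ 0 := fun h => hν2 (by linarith)
  unfold Ecal
  generalize 1 + β * ε.trace = d at hden
  constructor
  · intro h
    have htr := congrArg Matrix.trace h
    simp only [trace_sub, trace_smul, trace_one, Fintype.card_fin, smul_eq_mul] at htr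
    have hs : ε.trace = (1 - 2 * ν) * d / E * T.trace := by
      rw [htr]
      push_cast
      ring
    ext i j
    have hij := congrFun (congrFun h i) j
    simp only [Matrix.sub_apply, Matrix.add_apply, Matrix.smul_apply, smul_eq_mul] at hij ⊢
    rw [hij, hs]
    field_simp
    ring
  · intro h
    have htr := congrArg Matrix.trace h
    simp only [trace_add, trace_smul, trace_one, Fintype.card_fin, smul_eq_mul] at htr
    have hs : T.trace = E / ((1 - 2 * ν) * d) * ε.trace := by
      rw [htr]
      push_cast
      field_simp
      ring
    ext i j
    have hij := congrFun (congrFun h i) j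
    simp only [Matrix.sub_apply, Matrix.add_apply, Matrix.smul_apply, smul_eq_mul] at hij ⊢
    rw [hij, hs]
    field_simp
    ring
end

section
/- Let E, ν, β be real numbers with E > 0 and 0 < ν < 1/2. Then the density-dependent stress map ε ↦ 𝔼[ε]/(1+β·tr(ε)) is injective on the set of real 3×3 symmetric matrices ε satisfying 1 + β·tr(ε) ≠ 0: if ε₁ and ε₂ are symmetric with 1+β·tr(ε₁) ≠ 0, 1+β·tr(ε₂) ≠ 0 and 𝔼[ε₁]/(1+β·tr(ε₁)) = 𝔼[ε₂]/(1+β·tr(ε₂)), then ε₁ = ε₂. -/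
open Matrix

theorem Ecal_trace (E ν : ℝ) (M : Matrix (Fin 3) (Fin 3) ℝ) :
    (Ecal E ν M).trace =
      (E / (1 + ν) + 3 * (ν * E / ((1 + ν) * (1 - 2 * ν)))) * M.trace := by
  simp only [Ecal, Matrix.trace_add, Matrix.trace_smul, Matrix.trace_one, Fintype.card_fin,
    smul_eq_mul]
  push_cast
  ring

theorem density_dependent_stress_map_injective (E ν β : ℝ) (hE : 0 < E) (hν1 : 0 < ν)
    (hν2 : ν < 1 / 2) (ε₁ ε₂ : Matrix (Fin 3) (Fin 3) ℝ) (h1 : ε₁ = ε₁ᵀ) (h2 : ε₂ = ε₂ᵀ)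
    (hd1 : 1 + β * ε₁.trace ≠ 0) (hd2 : 1 + β * ε₂.trace ≠ 0)
    (heq : (1 + β * ε₁.trace)⁻¹ • Ecal E ν ε₁ = (1 + β * ε₂.trace)⁻¹ • Ecal E ν ε₂) :
    ε₁ = ε₂ := by
  have hν : 1 + ν ≠ 0 := by positivity
  have hc : E / (1 + ν) + 3 * (ν * E / ((1 + ν) * (1 - 2 * ν))) ≠ 0 := by
    have : 0 < 1 - 2 * ν := by linarith
    positivity
  have htr : ε₁.trace = ε₂.trace := by
    have h := congrArg Matrix.trace heq
    simp only [Matrix.trace_smul, Ecal_trace, smul_eq_mul] at h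
    rw [mul_left_comm, mul_left_comm (1 + β * ε₂.trace)⁻¹] at h
    have h' := mul_left_cancel₀ hc h
    field_simp at h'
    linarith
  rw [htr] at heq
  have hE' := smul_right_injective _ (inv_ne_zero hd2) heq
  simp only [Ecal, htr] at hE'
  exact smul_right_injective _ (div_ne_zero hE.ne' hν) (add_right_cancel hE')
end
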